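/- Let ũ ≠ w̃ be two distinct elements of (ZZ) or (PZZ). Then the decorated diagrams dec_Z(ũ) and dec_Z(w̃) are distinct. -/

import Mathlib

namespace BCF
open List

/-! ### Coxeter matrices of types `A_{n+1}` and `C̃_n`.

Generators are indexed by `Fin (n+1)`, with index `i` corresponding to the
generator `s_{i+1}` (resp. `s̃_{i+1}`) of the paper. -/

/-- Entries of the Coxeter matrix of affine type `C̃ₙ` (on indices `0, …, n`). -/
def cval (n a b : ℕ) : ℕ :=
  if a = b then 1
  else if max a b = min a b + 1 then (if min a b = 0 ∨ max a b = n then 4 else 3)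
  else 2

/-- Entries of the Coxeter matrix of type `A_{n+1}` (on indices `0, …, n`). -/
def aval (a b : ℕ) : ℕ :=
  if a = b then 1 else if max a b = min a b + 1 then 3 else 2

lemma cval_symm (n a b : ℕ) : cval n a b = cval n b a := by
  unfold cval
  rcases eq_or_ne a b with h | h
  · simp [h]
  · rw [if_neg h, if_neg (Ne.symm h), Nat.max_comm b a, Nat.min_comm b a]

lemma aval_symm (a b : ℕ) : aval a b = aval b a := by
  unfold aval
  rcases eq_or_ne a b with h | h
  · simp [h]
  · rw [if_neg h, if_neg (Ne.symm h), Nat.max_comm b a, Nat.min_comm b a]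

lemma cval_ne_one (n a b : ℕ) (h : a ≠ b) : cval n a b ≠ 1 := by
  unfold cval
  rw [if_neg h]
  split <;> [skip; omega]
  split <;> omega

lemma aval_ne_one (a b : ℕ) (h : a ≠ b) : aval a b ≠ 1 := by
  unfold aval
  rw [if_neg h]
  split <;> omega

/-- The Coxeter matrix of type `C̃ₙ` on the generator set `{s̃₁, …, s̃ₙ₊₁}`. -/
def CMat (n : ℕ) : CoxeterMatrix (Fin (n + 1)) where
  M := Matrix.of fun i j => cval n i.val j.val
  isSymm := by
    unfold Matrix.IsSymm
    ext i j
    exact cval_symm n j i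
  diagonal i := by simp [cval]
  off_diagonal i j h := cval_ne_one n i j (fun hc => h (Fin.ext hc))

/-- The Coxeter matrix of type `A_{n+1}` on the generator set `{s₁, …, sₙ₊₁}`. -/
def AMat (n : ℕ) : CoxeterMatrix (Fin (n + 1)) where
  M := Matrix.of fun i j => aval i.val j.val
  isSymm := by
    unfold Matrix.IsSymm
    ext i j
    exact aval_symm j i
  diagonal i := by simp [aval]
  off_diagonal i j h := aval_ne_one i j (fun hc => h (Fin.ext hc))

/-- The Coxeter group of type `C̃ₙ`. -/
abbrev WC (n : ℕ) : Type := (CMat n).Group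

/-- The Coxeter group of type `A_{n+1}`. -/
abbrev WA (n : ℕ) : Type := (AMat n).Group

/-- The Coxeter system of type `C̃ₙ`. -/
def csC (n : ℕ) : CoxeterSystem (CMat n) (WC n) := (CMat n).toCoxeterSystem

/-- The Coxeter system of type `A_{n+1}`. -/
def csA (n : ℕ) : CoxeterSystem (AMat n) (WA n) := (AMat n).toCoxeterSystem

/-! ### Commutation moves and fully commutative elements -/

/-- One commutation move: swap two adjacent commuting letters. -/
def CommMove {B : Type*} (Mx : CoxeterMatrix B) (l l' : List B) : Prop :=
  ∃ (u v : List B) (i j : B), Mx.M i j = 2 ∧ l = u ++ i :: j :: v ∧ l' = u ++ j :: i :: v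

/-- Two words are in the same commutation class. -/
def CommEquiv {B : Type*} (Mx : CoxeterMatrix B) : List B → List B → Prop :=
  Relation.ReflTransGen (CommMove Mx)

/-- An element of a Coxeter group is *fully commutative* (FC) if any reduced
expression for it can be obtained from any other by commutation moves only. -/
def IsFC {B : Type*} {W : Type*} [Group W] {Mx : CoxeterMatrix B}
    (cs : CoxeterSystem Mx W) (w : W) : Prop :=
  ∀ l l' : List B, cs.IsReduced l → cs.wordProd l = w →
    cs.IsReduced l' → cs.wordProd l' = w → CommEquiv Mx l l'

/-! ### The Temperley–Lieb algebra of type `A_{n+1}` -/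

noncomputable section

/-- The defining relations of the Temperley–Lieb algebra `TL(A_{n+1})`
over `ℤ[δ]`: (a1) `bᵢ² = δ bᵢ`; (a2) `bᵢbⱼ = bⱼbᵢ` for `|i-j| > 1`;
(a3) `bᵢbⱼbᵢ = bᵢ` for `|i-j| = 1`. -/
inductive TLRel (n : ℕ) :
    FreeAlgebra (Polynomial ℤ) (Fin (n + 1)) → FreeAlgebra (Polynomial ℤ) (Fin (n + 1)) → Prop
  | sq (i : Fin (n + 1)) :
      TLRel n (FreeAlgebra.ι (Polynomial ℤ) i * FreeAlgebra.ι (Polynomial ℤ) i)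
        ((Polynomial.X : Polynomial ℤ) • FreeAlgebra.ι (Polynomial ℤ) i)
  | comm (i j : Fin (n + 1)) (h : aval i.val j.val = 2) :
      TLRel n (FreeAlgebra.ι (Polynomial ℤ) i * FreeAlgebra.ι (Polynomial ℤ) j)
        (FreeAlgebra.ι (Polynomial ℤ) j * FreeAlgebra.ι (Polynomial ℤ) i)
  | braid (i j : Fin (n + 1)) (h : aval i.val j.val = 3) :
      TLRel n (FreeAlgebra.ι (Polynomial ℤ) i * FreeAlgebra.ι (Polynomial ℤ) j *
          FreeAlgebra.ι (Polynomial ℤ) i)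
        (FreeAlgebra.ι (Polynomial ℤ) i)

/-- The Temperley–Lieb algebra `TL(A_{n+1})` as a quotient of the free
`ℤ[δ]`-algebra on the generators `b₁, …, b_{n+1}`. -/
abbrev TLA (n : ℕ) : Type := RingQuot (TLRel n)

/-- The generator `b_{i+1}` of `TL(A_{n+1})`. -/
def tlGen (n : ℕ) (i : Fin (n + 1)) : TLA n :=
  RingQuot.mkAlgHom (Polynomial ℤ) (TLRel n) (FreeAlgebra.ι (Polynomial ℤ) i)

/-- The product `b_{i₁} ⋯ b_{i_k}` in `TL(A_{n+1})` associated with a word. -/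
def bProd (n : ℕ) (l : List (Fin (n + 1))) : TLA n := (l.map (tlGen n)).prod

/-- The element `δ` of `TL(A_{n+1})`. -/
def tlδ (n : ℕ) : TLA n := algebraMap (Polynomial ℤ) (TLA n) Polynomial.X

end

end BCF

namespace BCF

/-! ### Temperley–Lieb diagrams via stackings of simple diagrams.

A node of the standard `(n+2)`-box is `Sum.inl p` (the north node `p+1`) or
`Sum.inr p` (the south node `(p+1)'`).  The (loop-free part of the) diagram
`d_{i₁} ⋯ d_{i_k}` associated with a word is described through connectivity in the
stacking of the corresponding simple diagrams. -/

/-- Nodes of the standard `(n+2)`-box. -/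
abbrev Node (n : ℕ) := Fin (n + 2) ⊕ Fin (n + 2)

/-- The cup/cap of the simple diagram `d_{i+1}` occupies positions `i` and `i+1`. -/
def cupAt (n : ℕ) (i : Fin (n + 1)) (p q : Fin (n + 2)) : Prop :=
  (p.val = i.val ∧ q.val = i.val + 1) ∨ (q.val = i.val ∧ p.val = i.val + 1)

/-- One step along a curve of the stacking of the simple diagrams of the word `l`:
vertices are pairs (interface, position), where interface `t` lies between the
`t`-th and `(t+1)`-st simple diagram. -/
inductive LStep (n : ℕ) (l : List (Fin (n + 1))) :
    ℕ × Fin (n + 2) → ℕ × Fin (n + 2) → Prop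
  | cupN {t : ℕ} {p q : Fin (n + 2)} (ht : t < l.length)
      (h : cupAt n (l.get ⟨t, ht⟩) p q) : LStep n l (t, p) (t, q)
  | capS {t : ℕ} {p q : Fin (n + 2)} (ht : t < l.length)
      (h : cupAt n (l.get ⟨t, ht⟩) p q) : LStep n l (t + 1, p) (t + 1, q)
  | vert {t : ℕ} {p : Fin (n + 2)} (ht : t < l.length)
      (h : p.val ≠ (l.get ⟨t, ht⟩).val ∧ p.val ≠ (l.get ⟨t, ht⟩).val + 1) :
      LStep n l (t, p) (t + 1, p)

/-- Two points of the stacking lie on the same curve. -/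
def Conn (n : ℕ) (l : List (Fin (n + 1))) :
    ℕ × Fin (n + 2) → ℕ × Fin (n + 2) → Prop :=
  Relation.ReflTransGen (fun a b => LStep n l a b ∨ LStep n l b a)

/-- The boundary points of the stacking of the word `l`. -/
def bd (n : ℕ) (l : List (Fin (n + 1))) : Node n → ℕ × Fin (n + 2)
  | Sum.inl p => (0, p)
  | Sum.inr p => (l.length, p)

/-- `(h, k)` is an edge of the (loop-free) diagram of the word `l`. -/
def WordEdge (n : ℕ) (l : List (Fin (n + 1))) (h k : Node n) : Prop :=
  h ≠ k ∧ Conn n l (bd n l h) (bd n l k)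

/-- A point of the stacking lying on a loop (a closed curve missing the boundary). -/
def LoopVert (n : ℕ) (l : List (Fin (n + 1))) (v : ℕ × Fin (n + 2)) : Prop :=
  v.1 ≤ l.length ∧ ∀ h : Node n, ¬ Conn n l v (bd n l h)

/-- The number of loops of the diagram of the word `l`. -/
noncomputable def loopCount (n : ℕ) (l : List (Fin (n + 1))) : ℕ :=
  Nat.card (Quot (fun a b : { v // LoopVert n l v } => Conn n l a.1 b.1))

/-! ### Heaps, alternating heaps, forks and snake paths.

The heap of a word `l : List (Fin (n+1))` has underlying set `Fin l.length`,
with `e` labelled by the generator `l.get e`; its order is the transitive closure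
of the relation `e ≺ f` for `e` occurring before `f` with non-commuting labels.
Heaps are drawn from top to bottom. -/

/-- Non-commuting generators (equal or adjacent indices). -/
def nonComm {n : ℕ} (a b : Fin (n + 1)) : Prop :=
  a = b ∨ a.val + 1 = b.val ∨ b.val + 1 = a.val

section Heap

variable (n : ℕ) (l : List (Fin (n + 1)))

/-- The column (0-indexed) of an element of the heap of `l`. -/
def colOf (e : Fin l.length) : ℕ := (l.get e).val

/-- The heap order: `e` lies (strictly) above `f` in the heap of `l`. -/
def hLt (e f : Fin l.length) : Prop :=
  Relation.TransGen (fun a b : Fin l.length => a < b ∧ nonComm (l.get a) (l.get b)) e f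

/-- `f` covers `e` in the heap order (a Hasse edge, `e` above `f`). -/
def hCov (e f : Fin l.length) : Prop :=
  hLt n l e f ∧ ∀ g, ¬(hLt n l e g ∧ hLt n l g f)

/-- Adjacent columns. -/
def adjCol (e f : Fin l.length) : Prop :=
  colOf n l e + 1 = colOf n l f ∨ colOf n l f + 1 = colOf n l e

/-- A step of an up-down path: a Hasse edge between adjacent columns. -/
def HasseStep (e f : Fin l.length) : Prop :=
  adjCol n l e f ∧ (hCov n l e f ∨ hCov n l f e)

/-- `(a, c, b)` is a fork (a convex subheap with label sequence
`s̃_{i} s̃_{i±1} s̃_{i}`, with `a` its top node and `b` its bottom node). -/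
def ForkNodes (a c b : Fin l.length) : Prop :=
  hLt n l a c ∧ hLt n l c b ∧ colOf n l a = colOf n l b ∧ adjCol n l a c ∧
    ∀ g, hLt n l a g → hLt n l g b → g = c

/-- A left fork `s̃₁ s̃₂ s̃₁`. -/
def LeftForkN (a c b : Fin l.length) : Prop := ForkNodes n l a c b ∧ colOf n l a = 0

/-- A right fork `s̃ₙ₊₁ s̃ₙ s̃ₙ₊₁`. -/
def RightForkN (a c b : Fin l.length) : Prop := ForkNodes n l a c b ∧ colOf n l a = n

/-- A jump of a snake path between the two outer nodes of a left or right fork. -/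
def JumpStep (e f : Fin l.length) : Prop :=
  (colOf n l e = 0 ∨ colOf n l e = n) ∧
    ∃ c, ForkNodes n l e c f ∨ ForkNodes n l f c e

/-- A step of a snake path. -/
def SnakeStep (e f : Fin l.length) : Prop := HasseStep n l e f ∨ JumpStep n l e f

/-- Local conditions on three consecutive elements of a snake path: two consecutive
Hasse steps keep the horizontal direction and alternate the vertical direction;
jumps are isolated and the fork partner lies on the correct side (conditions (a)
and (b) of the snake algorithm). -/
def TripleOK (p : List (Fin l.length)) : Prop :=
  ∀ (t : ℕ) (h : t + 2 < p.length),
    ((adjCol n l (p[t]'(by omega)) (p[t+1]'(by omega)) ∧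
        adjCol n l (p[t+1]'(by omega)) (p[t+2]'h) ) →
      ((colOf n l (p[t]'(by omega)) < colOf n l (p[t+1]'(by omega)) ↔
          colOf n l (p[t+1]'(by omega)) < colOf n l (p[t+2]'h)) ∧
        (hLt n l (p[t]'(by omega)) (p[t+1]'(by omega)) ↔
          hLt n l (p[t+2]'h) (p[t+1]'(by omega))))) ∧
    (colOf n l (p[t]'(by omega)) = colOf n l (p[t+1]'(by omega)) →
      (adjCol n l (p[t+1]'(by omega)) (p[t+2]'h) ∧
        (hLt n l (p[t+1]'(by omega)) (p[t]'(by omega)) →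
          hLt n l (p[t+1]'(by omega)) (p[t+2]'h)) ∧
        (hLt n l (p[t]'(by omega)) (p[t+1]'(by omega)) →
          hLt n l (p[t+2]'h) (p[t+1]'(by omega))))) ∧
    (colOf n l (p[t+1]'(by omega)) = colOf n l (p[t+2]'h) →
      (adjCol n l (p[t]'(by omega)) (p[t+1]'(by omega)) ∧
        (hLt n l (p[t]'(by omega)) (p[t+1]'(by omega)) →
          hLt n l (p[t+2]'h) (p[t+1]'(by omega))) ∧
        (hLt n l (p[t+1]'(by omega)) (p[t]'(by omega)) →
          hLt n l (p[t+1]'(by omega)) (p[t+2]'h))))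

/-- At a jump, the horizontal direction of the path is reversed. -/
def QuadOK (p : List (Fin l.length)) : Prop :=
  ∀ (t : ℕ) (h : t + 3 < p.length),
    colOf n l (p[t+1]'(by omega)) = colOf n l (p[t+2]'(by omega)) →
      (colOf n l (p[t]'(by omega)) < colOf n l (p[t+1]'(by omega)) ↔
        colOf n l (p[t+3]'h) < colOf n l (p[t+2]'(by omega)))

/-- `f` continues the snake path arriving at `e0` via the step `e1 → e0`
(same horizontal direction, alternating vertical direction). -/
def ContStep (e1 e0 f : Fin l.length) : Prop :=
  HasseStep n l e0 f ∧
    (colOf n l e0 = colOf n l e1 + 1 ↔ colOf n l f = colOf n l e0 + 1) ∧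
    (hLt n l e1 e0 ↔ hLt n l f e0)

/-- The path arriving at `e0` via `e1 → e0` can be continued through a left or
right fork at `e0` (cases (a), (b) of step (UD1) of the snake algorithm). -/
def JumpCont (e1 e0 : Fin l.length) : Prop :=
  (colOf n l e0 = 0 ∨ colOf n l e0 = n) ∧
    ∃ c f, (hLt n l e1 e0 ∧ ForkNodes n l f c e0) ∨ (hLt n l e0 e1 ∧ ForkNodes n l e0 c f)

/-- The snake path stops at `e0` (arriving via `e1 → e0`). -/
def TerminalAt (e1 e0 : Fin l.length) : Prop :=
  (¬∃ f, ContStep n l e1 e0 f) ∧ ¬JumpCont n l e1 e0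

/-- `p` is (the list of nodes of) a snake path `γ(H, f)` produced by the snake
algorithm from a left or right fork, which is not a cycle. -/
structure IsForkSnake (p : List (Fin l.length)) : Prop where
  chain : List.Chain' (SnakeStep n l) p
  nodup : p.Nodup
  triple : TripleOK n l p
  quad : QuadOK n l p
  hasJump : ∃ (t : ℕ) (h : t + 1 < p.length),
    colOf n l (p[t]'(by omega)) = colOf n l (p[t+1]'h)
  ends : ∃ e0 e1 r f0 f1 s, p = e0 :: e1 :: r ∧ p.reverse = f0 :: f1 :: s ∧
    adjCol n l e0 e1 ∧ adjCol n l f0 f1 ∧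
    TerminalAt n l e1 e0 ∧ TerminalAt n l f1 f0

/-- The snake path `γ(H, f)` is the cycle `γ∞`. -/
def IsSnakeCycle (p : List (Fin l.length)) : Prop :=
  2 ≤ p.length ∧ p.Nodup ∧
    List.Chain' (SnakeStep n l) (p ++ p.take 2) ∧
    TripleOK n l (p ++ p.take 2) ∧ QuadOK n l (p ++ p.take 3)

/-- A (non-degenerate) snake path `γ_{→x,y}` not coming from a fork: a maximal
rightward up-down path. -/
structure IsFreeSnake (p : List (Fin l.length)) : Prop where
  chain : List.Chain' (HasseStep n l) p
  nodup : p.Nodup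
  rightward : ∀ (t : ℕ) (h : t + 1 < p.length),
    colOf n l (p[t]'(by omega)) + 1 = colOf n l (p[t+1]'h)
  alt : ∀ (t : ℕ) (h : t + 2 < p.length),
    hLt n l (p[t]'(by omega)) (p[t+1]'(by omega)) ↔
      hLt n l (p[t+2]'h) (p[t+1]'(by omega))
  ends : ∃ e0 e1 r f0 f1 s, p = e0 :: e1 :: r ∧ p.reverse = f0 :: f1 :: s ∧
    TerminalAt n l e1 e0 ∧ TerminalAt n l f1 f0

open Classical in
/-- The node of the standard `(n+2)`-box associated with the endpoint `e0` of a
snake path coming from a fork, where `e1 → e0` is the arrival step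
(Definition of `(h,k)_γ`, case (a)). -/
noncomputable def endNodeOf (e0 e1 : Fin l.length) : Node n :=
  if colOf n l e0 = colOf n l e1 + 1 then
    -- the arrival step goes rightward
    (if hLt n l e1 e0 then
      Sum.inl ⟨colOf n l e0 + 1, by have h := (l.get e0).isLt; unfold colOf; omega⟩
    else
      Sum.inr ⟨colOf n l e0 + 1, by have h := (l.get e0).isLt; unfold colOf; omega⟩)
  else
    -- the arrival step goes leftward
    (if hLt n l e1 e0 then
      Sum.inl ⟨colOf n l e0, by have h := (l.get e0).isLt; unfold colOf; omega⟩
    else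
      Sum.inr ⟨colOf n l e0, by have h := (l.get e0).isLt; unfold colOf; omega⟩)

/-- The pair of box nodes `(h, k)` associated with a fork snake path `p`:
`h` comes from the head of `p` and `k` from its last node. -/
def SnakeHK (p : List (Fin l.length)) (h k : Node n) : Prop :=
  ∃ e0 e1 r f0 f1 s, p = e0 :: e1 :: r ∧ p.reverse = f0 :: f1 :: s ∧
    h = endNodeOf n l e0 e1 ∧ k = endNodeOf n l f0 f1

open Classical in
/-- The node associated with the starting point of a free snake path
(Definition of `(h,k)_γ`, case (b)). -/
noncomputable def freeStartNode (e0 e1 : Fin l.length) : Node n :=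
  if hLt n l e1 e0 then
    Sum.inl ⟨colOf n l e0, by have h := (l.get e0).isLt; unfold colOf; omega⟩
  else
    Sum.inr ⟨colOf n l e0, by have h := (l.get e0).isLt; unfold colOf; omega⟩

open Classical in
/-- The node associated with the final point of a free snake path
(Definition of `(h,k)_γ`, case (b)); `f0` is the last node and `f1` the previous one. -/
noncomputable def freeEndNode (f0 f1 : Fin l.length) : Node n :=
  if hLt n l f1 f0 then
    Sum.inl ⟨colOf n l f0 + 1, by have h := (l.get f0).isLt; unfold colOf; omega⟩
  else
    Sum.inr ⟨colOf n l f0 + 1, by have h := (l.get f0).isLt; unfold colOf; omega⟩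

/-- The pair of box nodes `(h, k)` associated with a free snake path. -/
def FreeHK (p : List (Fin l.length)) (h k : Node n) : Prop :=
  ∃ e0 e1 r f0 f1 s, p = e0 :: e1 :: r ∧ p.reverse = f0 :: f1 :: s ∧
    h = freeStartNode n l e0 e1 ∧ k = freeEndNode n l f0 f1

end Heap

/-- The linear order `1 ≻ₗ 2 ≻ₗ … ≻ₗ n+2 ≻ₗ (n+2)' ≻ₗ … ≻ₗ 1'` on the nodes of the
standard `(n+2)`-box: `h ≻ₗ k` iff `lrank h < lrank k`. -/
def lrank (n : ℕ) : Node n → ℕ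
  | Sum.inl p => p.val
  | Sum.inr p => (n + 2) + (n + 1 - p.val)

/-- The linear order `n+2 ≻ᵣ … ≻ᵣ 1 ≻ᵣ 1' ≻ᵣ … ≻ᵣ (n+2)'` on the nodes of the
standard `(n+2)`-box: `h ≻ᵣ k` iff `rrank h < rrank k`. -/
def rrank (n : ℕ) : Node n → ℕ
  | Sum.inl p => n + 1 - p.val
  | Sum.inr p => (n + 2) + p.val

/-- `H(w̃)` is alternating: for all non-commuting generators `s, t` the chain
`H_{{s,t}}` has alternating labels. -/
def AltWord (n : ℕ) (l : List (Fin (n + 1))) : Prop :=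
  ∀ x : ℕ, x + 1 ≤ n →
    List.Chain' (· ≠ ·) (l.filter (fun i => decide (i.val = x ∨ i.val = x + 1)))

/-- `w̃ ∈ (ALT)`: a fully commutative element with alternating heap. -/
def IsALT (n : ℕ) (w : WC n) : Prop :=
  IsFC (csC n) w ∧
    ∃ l, (csC n).IsReduced l ∧ (csC n).wordProd l = w ∧ AltWord n l

end BCF

namespace BCF

/-! ### Decorated diagrams and the decoration algorithms -/

/-- The decorations `•`, `▲`, `∘`, `△`. -/
inductive Deco : Type
  | dot | btri | circ | wtri
deriving DecidableEq

/-- A decorated diagram in the standard `(n+2)`-box: an underlying matching of the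
nodes, a number of (decorated) loops, a decoration sequence on each (oriented) edge,
and the relative vertical order of the decorations (used for diagrams with a unique
non-propagating edge in each face). -/
structure DecDiagram (n : ℕ) : Type where
  edge : Node n → Node n → Prop
  loops : ℕ
  decs : Node n × Node n → List Deco
  vorder : List ((Node n × Node n) × Deco)

/-- The eastmost position of the box. -/
def topIdx (n : ℕ) : Fin (n + 2) := Fin.last (n + 1)

/-- The decoration prescribed at an end of an edge by step (D4) of the decoration
algorithm: a `•` at the nodes `1, 1'`, a `∘` at the nodes `n+2, (n+2)'`. -/
def endDeco (n : ℕ) (x : Node n) : List Deco :=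
  if x = Sum.inl (0 : Fin (n + 2)) ∨ x = Sum.inr (0 : Fin (n + 2)) then [Deco.dot]
  else if x = Sum.inl (topIdx n) ∨ x = Sum.inr (topIdx n) then [Deco.circ]
  else []

/-- The extreme vertical edges `(1, 1')` and `(n+2, (n+2)')`, which are left
undecorated by the decoration algorithm for alternating heaps. -/
def IsExtremeVertical (n : ℕ) (h k : Node n) : Prop :=
  (h = Sum.inl (0 : Fin (n + 2)) ∧ k = Sum.inr (0 : Fin (n + 2))) ∨
  (h = Sum.inr (0 : Fin (n + 2)) ∧ k = Sum.inl (0 : Fin (n + 2))) ∨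
  (h = Sum.inl (topIdx n) ∧ k = Sum.inr (topIdx n)) ∨
  (h = Sum.inr (topIdx n) ∧ k = Sum.inl (topIdx n))

/-- The sequence of decorations produced by step (D2) along a snake path: one `▲`
for each left fork crossed and one `△` for each right fork crossed, in order. -/
def triSeq (n : ℕ) (l : List (Fin (n + 1))) (p : List (Fin l.length)) : List Deco :=
  (p.zip p.tail).filterMap fun ef =>
    if colOf n l ef.1 = colOf n l ef.2 then
      (if colOf n l ef.1 = 0 then some Deco.btri else some Deco.wtri)
    else none

open Classical in
/-- The triangle decorations carried by the edge `(h,k)` of `d_{τ(w̃)}`: the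
decorations collected along the snake path of a fork with associated edge `(h,k)`,
if there is one. -/
noncomputable def coreDecs (n : ℕ) (l : List (Fin (n + 1))) (h k : Node n) :
    List Deco :=
  if hp : ∃ p : List (Fin l.length), IsForkSnake n l p ∧ SnakeHK n l p h k then
    triSeq n l hp.choose
  else []

open Classical in
/-- The full decoration sequence placed on the pair `(h,k)` by the decoration
algorithm for alternating heaps. -/
noncomputable def altDecs (n : ℕ) (l : List (Fin (n + 1))) (h k : Node n) :
    List Deco :=
  if ¬WordEdge n l h k then []
  else if IsExtremeVertical n h k then []
  else endDeco n h ++ coreDecs n l h k ++ endDeco n k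

/-- `d` is the decorated diagram `dec_A` produced from the word `l` (an alternating
reduced word) by the decoration algorithm for alternating heaps:  the underlying
diagram is `d_{τ(w̃)}`, there are `α(w̃)` decorated loops, each edge associated with a
fork snake path carries its triangle decorations in order, and a `•` (resp. `∘`) is
prepended at the ends incident to the nodes `1, 1'` (resp. `n+2, (n+2)'`). -/
def DecASpecWord (n : ℕ) (l : List (Fin (n + 1))) (d : DecDiagram n) : Prop :=
  (∀ h k, d.edge h k ↔ WordEdge n l h k) ∧
  d.loops = loopCount n l ∧
  d.vorder = [] ∧
  ∀ h k, d.decs (h, k) = altDecs n l h k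

/-- `d = dec_A(w̃)` for the alternating element `w̃`. -/
def DecASpec (n : ℕ) (w : WC n) (d : DecDiagram n) : Prop :=
  ∀ l, (csC n).IsReduced l → (csC n).wordProd l = w → DecASpecWord n l d

/-! ### The families (LP), (RP), (LRP), (ZZ), (PZZ) -/

/-- `w̃ ∈ (LP)` with left-peak index `j_ℓ = J + 1` (so `J` is the 0-indexed column of
`s̃_{j_ℓ}`). -/
def LPwith (n : ℕ) (J : ℕ) (w : WC n) : Prop :=
  1 ≤ J ∧ J + 1 ≤ n ∧ IsFC (csC n) w ∧
  ∃ l, (csC n).IsReduced l ∧ (csC n).wordProd l = w ∧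
    -- (1) the subheap on the labels `s̃₁, …, s̃_{j_ℓ}` is the left peak
    -- `P_←(s̃_{j_ℓ})`:
    (∃ l₁, CommEquiv (CMat n) (l.filter fun i => decide (i.val ≤ J)) l₁ ∧
      l₁.map Fin.val = (List.range (J + 1)).reverse ++ List.range' 1 J) ∧
    -- (2) there is no `s̃_{j_ℓ+1}`-element between the two `s̃_{j_ℓ}`-elements:
    (¬∃ u v w', (l.filter fun i => decide (i.val = J ∨ i.val = J + 1)).map Fin.val =
        u ++ [J] ++ v ++ [J] ++ w' ∧ (J + 1) ∈ v) ∧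
    -- (3) the subheap on the labels `s̃_{j_ℓ}, …, s̃ₙ₊₁` is alternating once one
    -- `s̃_{j_ℓ}`-element is deleted:
    (∃ (l₂ u v : List (Fin (n + 1))) (e : Fin (n + 1)),
      CommEquiv (CMat n) (l.filter fun i => decide (J ≤ i.val)) l₂ ∧
      l₂ = u ++ e :: v ∧ e.val = J ∧ AltWord n (u ++ v))

/-- `w̃ ∈ (RP)` with right-peak index `j_r = K + 1`. -/
def RPwith (n : ℕ) (K : ℕ) (w : WC n) : Prop :=
  1 ≤ K ∧ K + 1 ≤ n ∧ IsFC (csC n) w ∧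
  ∃ l, (csC n).IsReduced l ∧ (csC n).wordProd l = w ∧
    (∃ l₁, CommEquiv (CMat n) (l.filter fun i => decide (K ≤ i.val)) l₁ ∧
      l₁.map Fin.val = List.range' K (n - K + 1) ++ (List.range' K (n - K)).reverse) ∧
    (¬∃ u v w', (l.filter fun i => decide (i.val = K ∨ i.val + 1 = K)).map Fin.val =
        u ++ [K] ++ v ++ [K] ++ w' ∧ (K - 1) ∈ v) ∧
    (∃ (l₂ u v : List (Fin (n + 1))) (e : Fin (n + 1)),
      CommEquiv (CMat n) (l.filter fun i => decide (i.val ≤ K)) l₂ ∧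
      l₂ = u ++ e :: v ∧ e.val = K ∧ AltWord n (u ++ v))

/-- `w̃ ∈ (LRP)` with peak indices `j_ℓ = J + 1 < j_r = K + 1`. -/
def LRPwith (n : ℕ) (J K : ℕ) (w : WC n) : Prop :=
  1 ≤ J ∧ J < K ∧ K + 1 ≤ n ∧ IsFC (csC n) w ∧
  ∃ l, (csC n).IsReduced l ∧ (csC n).wordProd l = w ∧
    -- LP(1), LP(2):
    (∃ l₁, CommEquiv (CMat n) (l.filter fun i => decide (i.val ≤ J)) l₁ ∧
      l₁.map Fin.val = (List.range (J + 1)).reverse ++ List.range' 1 J) ∧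
    (¬∃ u v w', (l.filter fun i => decide (i.val = J ∨ i.val = J + 1)).map Fin.val =
        u ++ [J] ++ v ++ [J] ++ w' ∧ (J + 1) ∈ v) ∧
    -- RP(1), RP(2):
    (∃ l₁, CommEquiv (CMat n) (l.filter fun i => decide (K ≤ i.val)) l₁ ∧
      l₁.map Fin.val = List.range' K (n - K + 1) ++ (List.range' K (n - K)).reverse) ∧
    (¬∃ u v w', (l.filter fun i => decide (i.val = K ∨ i.val + 1 = K)).map Fin.val =
        u ++ [K] ++ v ++ [K] ++ w' ∧ (K - 1) ∈ v) ∧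
    -- the subheap on the labels `s̃_{j_ℓ}, …, s̃_{j_r}` is alternating once one
    -- `s̃_{j_ℓ}`- and one `s̃_{j_r}`-element are deleted:
    (∃ (l₂ u v w' : List (Fin (n + 1))) (e f : Fin (n + 1)),
      CommEquiv (CMat n) (l.filter fun i => decide (J ≤ i.val ∧ i.val ≤ K)) l₂ ∧
      l₂ = u ++ e :: v ++ f :: w' ∧
      ((e.val = J ∧ f.val = K) ∨ (e.val = K ∧ f.val = J)) ∧
      AltWord n (u ++ v ++ w'))

/-- The infinite word `(s̃₁ s̃₂ ⋯ s̃ₙ s̃ₙ₊₁ s̃ₙ ⋯ s̃₂ s̃₁)^∞`, as a function giving the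
(0-indexed) column of its `t`-th letter. -/
def zigv (n t : ℕ) : ℕ := if t % (2 * n) ≤ n then t % (2 * n) else 2 * n - t % (2 * n)

/-- `l` is a finite factor of the infinite word `(s̃₁ s̃₂ ⋯ s̃ₙ₊₁ ⋯ s̃₂ s̃₁)^∞`. -/
def IsZigWord (n : ℕ) (l : List (Fin (n + 1))) : Prop :=
  ∃ k, l.map Fin.val = (List.range l.length).map fun t => zigv n (k + t)

/-- `w̃ ∈ (ZZ)`. -/
def IsZZ (n : ℕ) (w : WC n) : Prop :=
  IsFC (csC n) w ∧
  ∃ l, (csC n).IsReduced l ∧ (csC n).wordProd l = w ∧ IsZigWord n l ∧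
    ∃ i, 1 ≤ i ∧ i + 1 ≤ n ∧ 3 ≤ (l.map Fin.val).count i

/-- `w̃ ∈ (PZZ)`. -/
def IsPZZ (n : ℕ) (w : WC n) : Prop :=
  IsFC (csC n) w ∧
  ∃ l, (csC n).IsReduced l ∧ (csC n).wordProd l = w ∧ IsZigWord n l ∧
    (∀ i, 1 ≤ i → i + 1 ≤ n → (l.map Fin.val).count i < 3) ∧
    (∃ u v, l.map Fin.val = u ++ [1, 0, 1] ++ v) ∧
    (∃ u v, l.map Fin.val = u ++ [n - 1, n, n - 1] ++ v)

/-! ### The decoration algorithm for peaks -/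

/-- `lsr` is a word of the semireduced heap of `l` for a left peak at column `J`
(the subheap on the labels `≥ s̃_{j_ℓ}` with one `s̃_{j_ℓ}`-element deleted). -/
def SemiLP (n J : ℕ) (l lsr : List (Fin (n + 1))) : Prop :=
  ∃ (l₂ u v : List (Fin (n + 1))) (e : Fin (n + 1)),
    CommEquiv (CMat n) (l.filter fun i => decide (J ≤ i.val)) l₂ ∧
    l₂ = u ++ e :: v ∧ e.val = J ∧ lsr = u ++ v

/-- `lsr` is a word of the semireduced heap of `l` for a right peak at column `K`. -/
def SemiRP (n K : ℕ) (l lsr : List (Fin (n + 1))) : Prop :=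
  ∃ (l₂ u v : List (Fin (n + 1))) (e : Fin (n + 1)),
    CommEquiv (CMat n) (l.filter fun i => decide (i.val ≤ K)) l₂ ∧
    l₂ = u ++ e :: v ∧ e.val = K ∧ lsr = u ++ v

/-- `lsr` is a word of the semireduced heap of `l` for a left-right peak. -/
def SemiLRP (n J K : ℕ) (l lsr : List (Fin (n + 1))) : Prop :=
  ∃ (l₂ u v w' : List (Fin (n + 1))) (e f : Fin (n + 1)),
    CommEquiv (CMat n) (l.filter fun i => decide (J ≤ i.val ∧ i.val ≤ K)) l₂ ∧
    l₂ = u ++ e :: v ++ f :: w' ∧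
    ((e.val = J ∧ f.val = K) ∨ (e.val = K ∧ f.val = J)) ∧
    lsr = u ++ v ++ w'

/-- `d` is obtained from `d₀` by adding a `▲` on the edge `(1,1')` (if `lft`) and a
`△` on the edge `(n+2,(n+2)')` (if `rgt`), leaving everything else unchanged
(steps (DP2), (DP3) of the decoration algorithm for peaks). -/
def PAdd (n : ℕ) (d₀ d : DecDiagram n) (lft rgt : Prop) : Prop :=
  (∀ h k, d.edge h k ↔ d₀.edge h k) ∧ d.loops = d₀.loops ∧ d.vorder = d₀.vorder ∧
  (∀ p : Node n × Node n,
    ¬IsExtremeVertical n p.1 p.2 → d.decs p = d₀.decs p) ∧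
  (lft → d.decs (Sum.inl (0 : Fin (n + 2)), Sum.inr (0 : Fin (n + 2))) = [Deco.btri] ∧
    d.decs (Sum.inr (0 : Fin (n + 2)), Sum.inl (0 : Fin (n + 2))) = [Deco.btri]) ∧
  (¬lft → d.decs (Sum.inl (0 : Fin (n + 2)), Sum.inr (0 : Fin (n + 2))) =
      d₀.decs (Sum.inl (0 : Fin (n + 2)), Sum.inr (0 : Fin (n + 2))) ∧
    d.decs (Sum.inr (0 : Fin (n + 2)), Sum.inl (0 : Fin (n + 2))) =
      d₀.decs (Sum.inr (0 : Fin (n + 2)), Sum.inl (0 : Fin (n + 2)))) ∧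
  (rgt → d.decs (Sum.inl (topIdx n), Sum.inr (topIdx n)) = [Deco.wtri] ∧
    d.decs (Sum.inr (topIdx n), Sum.inl (topIdx n)) = [Deco.wtri]) ∧
  (¬rgt → d.decs (Sum.inl (topIdx n), Sum.inr (topIdx n)) =
      d₀.decs (Sum.inl (topIdx n), Sum.inr (topIdx n)) ∧
    d.decs (Sum.inr (topIdx n), Sum.inl (topIdx n)) =
      d₀.decs (Sum.inr (topIdx n), Sum.inl (topIdx n)))

/-- `d = dec_P(w̃)` for `w̃ ∈ (LP) ∪ (RP) ∪ (LRP−Z)`: the decorated diagram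
`dec_A(w̃_sr)` of the semireduced alternating element, with a `▲` added on `(1,1')`
for a left peak and a `△` added on `(n+2,(n+2)')` for a right peak. -/
def DecPSpec (n : ℕ) (w : WC n) (d : DecDiagram n) : Prop :=
  (∃ J, LPwith n J w ∧
    ∃ l lsr d₀, (csC n).IsReduced l ∧ (csC n).wordProd l = w ∧ SemiLP n J l lsr ∧
      DecASpecWord n lsr d₀ ∧ PAdd n d₀ d True False) ∨
  (∃ K, RPwith n K w ∧
    ∃ l lsr d₀, (csC n).IsReduced l ∧ (csC n).wordProd l = w ∧ SemiRP n K l lsr ∧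
      DecASpecWord n lsr d₀ ∧ PAdd n d₀ d False True) ∨
  (∃ J K, LRPwith n J K w ∧ ¬IsPZZ n w ∧
    ∃ l lsr d₀, (csC n).IsReduced l ∧ (csC n).wordProd l = w ∧ SemiLRP n J K l lsr ∧
      DecASpecWord n lsr d₀ ∧ PAdd n d₀ d True True)

/-! ### The decoration algorithm for zigzags -/

open Classical in
/-- A list of `c` copies of the decoration `D`, with the first one replaced by `E`
if `s` holds and the last one replaced by `E` if `e` holds. -/
noncomputable def markEnds (c : ℕ) (s e : Prop) (D E : Deco) : List Deco :=
  List.ofFn fun t : Fin c => if (t.val = 0 ∧ s) ∨ (t.val = c - 1 ∧ e) then E else D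

open Classical in
/-- `d = dec_Z(w̃)` for `w̃ ∈ (ZZ) ∪ (PZZ)`. -/
noncomputable def DecZSpec (n : ℕ) (w : WC n) (d : DecDiagram n) : Prop :=
  ∀ l, (csC n).IsReduced l → (csC n).wordProd l = w →
    (∀ h k, d.edge h k ↔ WordEdge n l h k) ∧ d.loops = 0 ∧
    ∃ a b a' b' : Fin (n + 2),
      -- the first and last propagating edges:
      d.edge (Sum.inl a) (Sum.inr b) ∧ (∀ x y, d.edge (Sum.inl x) (Sum.inr y) → a ≤ x) ∧
      d.edge (Sum.inl a') (Sum.inr b') ∧ (∀ x y, d.edge (Sum.inl x) (Sum.inr y) → x ≤ a') ∧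
      -- (ZZ2)-(ZZ4): one `▲` per occurrence of `s̃₁` on the first propagating edge and
      -- one `△` per occurrence of `s̃ₙ₊₁` on the last one, the extremal ones replaced
      -- by `•`/`∘` when the word starts or ends with `s̃₁`/`s̃ₙ₊₁`:
      d.decs (Sum.inl a, Sum.inr b) =
        markEnds ((l.map Fin.val).count 0)
          ((l.map Fin.val).head? = some 0) ((l.map Fin.val).getLast? = some 0)
          Deco.btri Deco.dot ∧
      d.decs (Sum.inl a', Sum.inr b') =
        markEnds ((l.map Fin.val).count n)
          ((l.map Fin.val).head? = some n) ((l.map Fin.val).getLast? = some n)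
          Deco.wtri Deco.circ ∧
      -- the `•`/`∘` added on the boundary cups:
      ((l.map Fin.val).head? = some 0 →
        ∀ (h1 : (1 : ℕ) < n + 2), d.decs (Sum.inl 0, Sum.inl ⟨1, h1⟩) = [Deco.dot]) ∧
      ((l.map Fin.val).getLast? = some 0 →
        ∀ (h1 : (1 : ℕ) < n + 2), d.decs (Sum.inr 0, Sum.inr ⟨1, h1⟩) = [Deco.dot]) ∧
      ((l.map Fin.val).head? = some n →
        ∀ (h1 : n < n + 2), d.decs (Sum.inl ⟨n, h1⟩, Sum.inl (topIdx n)) = [Deco.circ]) ∧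
      ((l.map Fin.val).getLast? = some n →
        ∀ (h1 : n < n + 2), d.decs (Sum.inr ⟨n, h1⟩, Sum.inr (topIdx n)) = [Deco.circ]) ∧
      -- (ZZ5): the vertical positions of the decorations are compatible with the
      -- relative order of the nodes labelled `s̃₁` and `s̃ₙ₊₁` in `H(w̃)`:
      d.vorder = l.filterMap fun i =>
        if i.val = 0 then some ((Sum.inl a, Sum.inr b), Deco.btri)
        else if i.val = n then some ((Sum.inl a', Sum.inr b'), Deco.wtri)
        else none

/-! ### The combined decoration map, admissible diagrams and diagram classes -/

/-- `w̃ ∈ (LP) ∪ (RP) ∪ (LRP−Z)`. -/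
def IsPeak (n : ℕ) (w : WC n) : Prop :=
  (∃ J, LPwith n J w) ∨ (∃ K, RPwith n K w) ∨
    (∃ J K, LRPwith n J K w ∧ ¬IsPZZ n w)

/-- `d = dec(w̃)`, where `dec` is `dec_A` on `(ALT)`, `dec_P` on
`(LP) ∪ (RP) ∪ (LRP−Z)` and `dec_Z` on `(ZZ) ∪ (PZZ)`. -/
def DecSpec (n : ℕ) (w : WC n) (d : DecDiagram n) : Prop :=
  (IsALT n w ∧ DecASpec n w d) ∨
  (IsPeak n w ∧ DecPSpec n w d) ∨
  ((IsZZ n w ∨ IsPZZ n w) ∧ DecZSpec n w d)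

/-- Admissible diagrams: by Ernst's theorem these are exactly the images of the
monomial basis under `θ̃`, i.e. the decorated diagrams of fully commutative
elements of type `C̃ₙ`. -/
def Admissible (n : ℕ) (d : DecDiagram n) : Prop :=
  ∃ w : WC n, IsFC (csC n) w ∧ DecSpec n w d

/-- `a(d)`: the number of non-propagating edges in the north face of `d`. -/
noncomputable def aOf (n : ℕ) (d : DecDiagram n) : ℕ :=
  Nat.card {p : Fin (n + 2) × Fin (n + 2) //
    p.1 < p.2 ∧ d.edge (Sum.inl p.1) (Sum.inl p.2)}

/-- A `Z`-diagram. -/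
def ZDiag (n : ℕ) (d : DecDiagram n) : Prop :=
  Admissible n d ∧ aOf n d = 1 ∧
  (∃ a b : Fin (n + 2), d.edge (Sum.inl a) (Sum.inr b) ∧
    (∀ x y, d.edge (Sum.inl x) (Sum.inr y) → a ≤ x) ∧
    Deco.btri ∈ d.decs (Sum.inl a, Sum.inr b)) ∧
  (∃ a b : Fin (n + 2), d.edge (Sum.inl a) (Sum.inr b) ∧
    (∀ x y, d.edge (Sum.inl x) (Sum.inr y) → x ≤ a) ∧
    Deco.wtri ∈ d.decs (Sum.inl a, Sum.inr b))

/-- A `P`-diagram. -/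
def PDiag (n : ℕ) (d : DecDiagram n) : Prop :=
  Admissible n d ∧ ¬ZDiag n d ∧
  ((d.edge (Sum.inl (0 : Fin (n + 2))) (Sum.inr (0 : Fin (n + 2))) ∧
      Deco.btri ∈ d.decs (Sum.inl (0 : Fin (n + 2)), Sum.inr (0 : Fin (n + 2)))) ∨
   (d.edge (Sum.inl (topIdx n)) (Sum.inr (topIdx n)) ∧
      Deco.wtri ∈ d.decs (Sum.inl (topIdx n), Sum.inr (topIdx n))))

/-- An `A`-diagram. -/
def ADiag (n : ℕ) (d : DecDiagram n) : Prop :=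
  Admissible n d ∧ ¬ZDiag n d ∧ ¬PDiag n d

end BCF

namespace BCF

/-! ### Helper lemmas: the underlying diagram of a zigzag word -/

def strandVal (n len : ℕ) (g : ℕ → ℕ) (v : ℕ × Fin (n + 2)) : ℕ :=
  if v.1 = 0 then
    (if v.2.val < g 0 then v.2.val else if v.2.val ≤ g 0 + 1 then n + 10 else v.2.val - 2)
  else if v.1 = len then
    (if v.2.val < g (len - 1) then v.2.val
      else if v.2.val ≤ g (len - 1) + 1 then n + 11 else v.2.val - 2)
  else
    (if v.2.val ≤ min (g (v.1 - 1)) (g v.1) then v.2.val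
      else if v.2.val = min (g (v.1 - 1)) (g v.1) + 1 then min (g (v.1 - 1)) (g v.1)
      else v.2.val - 2)

lemma strandVal_step (n : ℕ) (l : List (Fin (n + 1))) (g : ℕ → ℕ)
    (hg : ∀ t (h : t < l.length), (l.get ⟨t, h⟩).val = g t)
    (hadj : ∀ t, t + 1 < l.length → g (t + 1) = g t + 1 ∨ g t = g (t + 1) + 1)
    (x y : ℕ × Fin (n + 2)) (h : LStep n l x y) :
    strandVal n l.length g x = strandVal n l.length g y := by
  cases h with
  | @cupN t p q ht h =>
    unfold cupAt at h
    rw [hg t ht] at h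
    unfold strandVal
    dsimp only
    rcases Nat.eq_zero_or_pos t with h0 | h0
    · subst h0
      simp only [if_true]
      split_ifs <;> omega
    · obtain ⟨s, rfl⟩ : ∃ s, t = s + 1 := ⟨t - 1, by omega⟩
      have := hadj s ht
      simp only [if_neg (show ¬ s + 1 = 0 by omega), if_neg (show ¬ s + 1 = l.length by omega),
        Nat.add_sub_cancel]
      split_ifs <;> omega
  | @capS t p q ht h =>
    unfold cupAt at h
    rw [hg t ht] at h
    unfold strandVal
    dsimp only
    simp only [if_neg (show ¬ t + 1 = 0 by omega)]
    by_cases h1 : t + 1 = l.length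
    · simp only [if_pos h1]
      rw [← h1]
      simp only [Nat.add_sub_cancel]
      split_ifs <;> omega
    · have := hadj t (by omega)
      simp only [if_neg h1, Nat.add_sub_cancel]
      split_ifs <;> omega
  | @vert t p ht h =>
    rw [hg t ht] at h
    unfold strandVal
    dsimp only
    have e : (if t + 1 = 0 then (if p.val < g 0 then p.val
          else if p.val ≤ g 0 + 1 then n + 10 else p.val - 2)
        else if t + 1 = l.length then
          (if p.val < g (l.length - 1) then p.val
            else if p.val ≤ g (l.length - 1) + 1 then n + 11 else p.val - 2)
        else
          (if p.val ≤ min (g (t + 1 - 1)) (g (t + 1)) then p.val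
            else if p.val = min (g (t + 1 - 1)) (g (t + 1)) + 1 then
              min (g (t + 1 - 1)) (g (t + 1))
            else p.val - 2)) = if p.val < g t then p.val else p.val - 2 := by
      rw [if_neg (show ¬ t + 1 = 0 by omega)]
      by_cases h1 : t + 1 = l.length
      · rw [if_pos h1, ← h1]
        simp only [Nat.add_sub_cancel]
        split_ifs <;> omega
      · have := hadj t (by omega)
        rw [if_neg h1]
        simp only [Nat.add_sub_cancel]
        split_ifs <;> omega
    rw [e]
    rcases Nat.eq_zero_or_pos t with h0 | h0
    · subst h0
      simp only [if_true]
      split_ifs <;> omega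
    · obtain ⟨s, rfl⟩ : ∃ s, t = s + 1 := ⟨t - 1, by omega⟩
      have := hadj s ht
      simp only [if_neg (show ¬ s + 1 = 0 by omega), if_neg (show ¬ s + 1 = l.length by omega),
        Nat.add_sub_cancel]
      split_ifs <;> omega

lemma strandVal_conn (n : ℕ) (l : List (Fin (n + 1))) (g : ℕ → ℕ)
    (hg : ∀ t (h : t < l.length), (l.get ⟨t, h⟩).val = g t)
    (hadj : ∀ t, t + 1 < l.length → g (t + 1) = g t + 1 ∨ g t = g (t + 1) + 1)
    (x y : ℕ × Fin (n + 2)) (h : Conn n l x y) :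
    strandVal n l.length g x = strandVal n l.length g y := by
  induction h with
  | refl => rfl
  | tail _ h ih =>
    rw [ih]
    rcases h with h | h
    · exact strandVal_step n l g hg hadj _ _ h
    · exact (strandVal_step n l g hg hadj _ _ h).symm

lemma aux_ite (c s p : ℕ) (hs : p + 1 < s)
    (h : (if p < c then p else if p ≤ c + 1 then s else p - 2) =
      (if p + 1 < c then p + 1 else if p + 1 ≤ c + 1 then s else p + 1 - 2)) : p = c := by
  by_contra hc
  rcases Nat.lt_or_ge p c with h1 | h1
  · rw [if_pos h1] at h
    by_cases h2 : p + 1 < c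
    · rw [if_pos h2] at h; omega
    · rw [if_neg h2, if_pos (by omega)] at h; omega
  · rw [if_neg (by omega), if_neg (show ¬ p + 1 < c by omega),
      if_neg (show ¬ p + 1 ≤ c + 1 by omega)] at h
    by_cases h2 : p ≤ c + 1
    · rw [if_pos h2] at h; omega
    · rw [if_neg h2] at h; omega

lemma north_edge (n : ℕ) (l : List (Fin (n + 1))) (g : ℕ → ℕ)
    (hg : ∀ t (h : t < l.length), (l.get ⟨t, h⟩).val = g t)
    (hadj : ∀ t, t + 1 < l.length → g (t + 1) = g t + 1 ∨ g t = g (t + 1) + 1)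
    (p q : Fin (n + 2)) (hpq : p.val + 1 = q.val)
    (h : WordEdge n l (Sum.inl p) (Sum.inl q)) : p.val = g 0 := by
  have := strandVal_conn n l g hg hadj _ _ h.2
  simp only [bd, strandVal, if_true] at this
  obtain ⟨p, hp⟩ := p
  obtain ⟨q, hq⟩ := q
  dsimp only at *
  subst hpq
  exact aux_ite _ _ p (by omega) this

lemma south_edge (n : ℕ) (l : List (Fin (n + 1))) (g : ℕ → ℕ) (hl : 0 < l.length)
    (hg : ∀ t (h : t < l.length), (l.get ⟨t, h⟩).val = g t)
    (hadj : ∀ t, t + 1 < l.length → g (t + 1) = g t + 1 ∨ g t = g (t + 1) + 1)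
    (p q : Fin (n + 2)) (hpq : p.val + 1 = q.val)
    (h : WordEdge n l (Sum.inr p) (Sum.inr q)) : p.val = g (l.length - 1) := by
  have := strandVal_conn n l g hg hadj _ _ h.2
  simp only [bd, strandVal, if_true, if_neg (show ¬ l.length = 0 by omega)] at this
  obtain ⟨p, hp⟩ := p
  obtain ⟨q, hq⟩ := q
  dsimp only at *
  subst hpq
  exact aux_ite _ _ p (by omega) this

lemma north_mem (n : ℕ) (l : List (Fin (n + 1))) (hl : 0 < l.length)
    (p q : Fin (n + 2)) (hpq : p.val + 1 = q.val) (hp : p.val = (l.get ⟨0, hl⟩).val) :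
    WordEdge n l (Sum.inl p) (Sum.inl q) := by
  refine ⟨?_, Relation.ReflTransGen.single (Or.inl ?_)⟩
  · intro h
    have := Sum.inl.inj h
    subst this
    omega
  · exact LStep.cupN hl (Or.inl ⟨hp, by omega⟩)

lemma south_mem (n : ℕ) (l : List (Fin (n + 1))) (hl : 0 < l.length)
    (p q : Fin (n + 2)) (hpq : p.val + 1 = q.val)
    (hp : p.val = (l.get ⟨l.length - 1, by omega⟩).val) :
    WordEdge n l (Sum.inr p) (Sum.inr q) := by
  refine ⟨?_, Relation.ReflTransGen.single (Or.inl ?_)⟩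
  · intro h
    have := Sum.inr.inj h
    subst this
    omega
  · have := LStep.capS (n := n) (l := l) (t := l.length - 1) (p := p) (q := q) (by omega)
      (Or.inl ⟨hp, by omega⟩)
    have e : l.length - 1 + 1 = l.length := by omega
    rw [e] at this
    exact this

/-! ### Helper lemmas: the zigzag word -/

lemma zigv_form (n Q r : ℕ) (hr : r < 2 * n) :
    zigv n (2 * n * Q + r) = if r ≤ n then r else 2 * n - r := by
  unfold zigv
  rw [Nat.mul_add_mod, Nat.mod_eq_of_lt hr]

lemma form (n x : ℕ) (hn : 2 ≤ n) : ∃ Q r, r < 2 * n ∧ x = 2 * n * Q + r ∧ x % (2 * n) = r :=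
  ⟨x / (2 * n), x % (2 * n), Nat.mod_lt _ (by omega), (Nat.div_add_mod _ _).symm, rfl⟩

lemma zigv_le (n x : ℕ) : zigv n x ≤ n := by
  unfold zigv
  split_ifs <;> omega

lemma zigv_succ (n x : ℕ) (hn : 2 ≤ n) :
    zigv n (x + 1) = zigv n x + 1 ∨ zigv n x = zigv n (x + 1) + 1 := by
  obtain ⟨Q, r, hr, rfl, -⟩ := form n x hn
  rw [zigv_form n Q r hr]
  by_cases h : r + 1 < 2 * n
  · rw [add_assoc, zigv_form n Q (r + 1) h]
    split_ifs <;> omega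
  · have e : 2 * n * Q + r + 1 = 2 * n * (Q + 1) + 0 := by
      rw [mul_add]; omega
    rw [e, zigv_form n (Q + 1) 0 (by omega)]
    split_ifs <;> omega

lemma seg (n x y : ℕ) (hn : 2 ≤ n) (hxy : x < y)
    (hE : ∀ z, x < z → z ≤ y → zigv n z ≠ 0 ∧ zigv n z ≠ n) :
    (x % (2 * n) < n → zigv n x < zigv n y) ∧ (n ≤ x % (2 * n) → zigv n y < zigv n x) := by
  obtain ⟨Q, r, hr, rfl, h⟩ := form n x hn
  rw [h]
  obtain ⟨e, rfl⟩ := Nat.exists_eq_add_of_lt hxy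
  constructor
  · intro hrn
    by_cases he : e + 1 < n - r
    · have : 2 * n * Q + r + e + 1 = 2 * n * Q + (r + e + 1) := by omega
      rw [this, zigv_form n Q r hr, zigv_form n Q _ (by omega)]
      split_ifs <;> omega
    · have := (hE (2 * n * Q + n) (by omega) (by omega)).2
      rw [zigv_form n Q n (by omega)] at this
      simp at this
  · intro hrn
    by_cases he : e + 1 < 2 * n - r
    · have : 2 * n * Q + r + e + 1 = 2 * n * Q + (r + e + 1) := by omega
      rw [this, zigv_form n Q r hr, zigv_form n Q _ (by omega)]
      split_ifs <;> omega
    · have e1 : 2 * n * (Q + 1) = 2 * n * Q + 2 * n := by ring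
      have := (hE (2 * n * (Q + 1) + 0) (by omega) (by omega)).1
      rw [zigv_form n (Q + 1) 0 (by omega)] at this
      simp at this

def decoOf (n x : ℕ) : Option Deco :=
  if x = 0 then some Deco.btri else if x = n then some Deco.wtri else none

def zw (n k L : ℕ) : List ℕ := (List.range' k L).map (zigv n)

lemma zw_succ (n k L : ℕ) : zw n k (L + 1) = zigv n k :: zw n (k + 1) L := by
  simp [zw, List.range'_succ]

lemma first_ext (n : ℕ) (hn : 2 ≤ n) (L : ℕ) : ∀ (k : ℕ) (D : Deco),
    ((zw n k L).filterMap (decoOf n)).head? = some D →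
    D = if k % (2 * n) = 0 ∨ n < k % (2 * n) then Deco.btri else Deco.wtri := by
  induction L with
  | zero => intro k D h; simp [zw] at h
  | succ L ih =>
    intro k D h
    rw [zw_succ] at h
    obtain ⟨Q, r, hr, hk, hm⟩ := form n k hn
    have hz := zigv_form n Q r hr
    rw [← hk] at hz
    rw [hm]
    by_cases h0 : r = 0
    · have : decoOf n (zigv n k) = some Deco.btri := by
        rw [hz]; simp [decoOf, h0]
      rw [List.filterMap_cons_some this] at h
      simp at h
      simp [h0, h]
    by_cases h1 : r = n
    · have : decoOf n (zigv n k) = some Deco.wtri := by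
        rw [hz]; subst h1; simp [decoOf, h0]
      rw [List.filterMap_cons_some this] at h
      simp at h
      subst h1
      simp [h0, h]
    have : decoOf n (zigv n k) = none := by
      rw [hz]; unfold decoOf
      split_ifs <;> first | rfl | omega
    rw [List.filterMap_cons_none this] at h
    have h2 := ih _ _ h
    rw [h2]
    by_cases h3 : r + 1 < 2 * n
    · have : (k + 1) % (2 * n) = r + 1 := by
        rw [hk, add_assoc, Nat.mul_add_mod, Nat.mod_eq_of_lt h3]
      rw [this]
      congr 1
      apply propext; omega
    · have : (k + 1) % (2 * n) = 0 := by
        have e : k + 1 = 2 * n * (Q + 1) := by rw [mul_add]; omega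
        rw [e, Nat.mul_mod_right]
      rw [this]
      congr 1
      apply propext; omega

lemma no_ext (n k L : ℕ) (h : (zw n k L).filterMap (decoOf n) = []) (z : ℕ)
    (h1 : k ≤ z) (h2 : z < k + L) : zigv n z ≠ 0 ∧ zigv n z ≠ n := by
  rw [List.filterMap_eq_nil_iff] at h
  have := h (zigv n z) (List.mem_map_of_mem (by simp [List.mem_range']; exact ⟨z - k, by omega, by omega⟩))
  unfold decoOf at this
  split_ifs at this with a b
  exact ⟨a, b⟩

lemma len_eq (n k L L' : ℕ) (hn : 2 ≤ n) (hL : 1 ≤ L) (hLL : L < L')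
    (hlast : zigv n (k + L - 1) = zigv n (k + L' - 1))
    (hF : (zw n k L).filterMap (decoOf n) = (zw n k L').filterMap (decoOf n)) : False := by
  obtain ⟨e, rfl⟩ : ∃ e, L' = L + e := ⟨L' - L, by omega⟩
  have e1 : zw n k (L + e) = zw n k L ++ zw n (k + L) e := by
    unfold zw
    rw [← List.map_append, List.range'_append_1]
  rw [e1, List.filterMap_append] at hF
  have hnil := List.self_eq_append_right.mp hF
  have := seg n (k + L - 1) (k + (L + e) - 1) hn (by omega)
    (fun z h1 h2 => no_ext n _ _ hnil z (by omega) (by omega))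
  rcases lt_or_ge ((k + L - 1) % (2 * n)) n with h | h
  · have := this.1 h; omega
  · have := this.2 h; omega

lemma zw_eq (n k L k' L' : ℕ) (hn : 2 ≤ n) (hL : 1 ≤ L) (hL' : 1 ≤ L')
    (hhead : zigv n k = zigv n k')
    (hlast : zigv n (k + L - 1) = zigv n (k' + L' - 1))
    (hF : (zw n k L).filterMap (decoOf n) = (zw n k' L').filterMap (decoOf n)) :
    zw n k L = zw n k' L' := by
  by_cases hmod : k % (2 * n) = k' % (2 * n)
  · have hz : ∀ t, zigv n (k + t) = zigv n (k' + t) := by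
      intro t
      have : (k + t) % (2 * n) = (k' + t) % (2 * n) := Nat.ModEq.add_right t hmod
      unfold zigv
      rw [this]
    have hw : zw n k' L' = zw n k L' := by
      unfold zw
      rw [List.range'_eq_map_range, List.range'_eq_map_range, List.map_map, List.map_map]
      apply List.map_congr_left
      intro t _
      exact (hz t).symm
    have hl : zigv n (k' + L' - 1) = zigv n (k + L' - 1) := by
      have := hz (L' - 1)
      rw [show k' + L' - 1 = k' + (L' - 1) by omega, show k + L' - 1 = k + (L' - 1) by omega, this]
    rw [hw] at hF ⊢
    rw [hl] at hlast
    rcases lt_trichotomy L L' with h | h | h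
    · exact (len_eq n k L L' hn hL h hlast hF).elim
    · rw [h]
    · exact (len_eq n k L' L hn hL' h hlast.symm hF.symm).elim
  · have hsum : k % (2 * n) + k' % (2 * n) = 2 * n := by
      have h1 := Nat.mod_lt k (show 0 < 2 * n by omega)
      have h2 := Nat.mod_lt k' (show 0 < 2 * n by omega)
      unfold zigv at hhead
      split_ifs at hhead <;> omega
    have h1 := Nat.mod_lt k (show 0 < 2 * n by omega)
    have h2 := Nat.mod_lt k' (show 0 < 2 * n by omega)
    rcases hh : ((zw n k L).filterMap (decoOf n)).head? with _ | D
    · have hnil := List.head?_eq_none_iff.mp hh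
      have hnil' := hnil
      rw [hF] at hnil'
      have s1 := seg n k (k + L - 1) hn
      have s2 := seg n k' (k' + L' - 1) hn
      have c1 : 1 < L → (k % (2 * n) < n → zigv n k < zigv n (k + L - 1)) ∧
          (n ≤ k % (2 * n) → zigv n (k + L - 1) < zigv n k) := fun h =>
        s1 (by omega) (fun z a b => no_ext n _ _ hnil z (by omega) (by omega))
      have c2 : 1 < L' → (k' % (2 * n) < n → zigv n k' < zigv n (k' + L' - 1)) ∧
          (n ≤ k' % (2 * n) → zigv n (k' + L' - 1) < zigv n k') := fun h =>
        s2 (by omega) (fun z a b => no_ext n _ _ hnil' z (by omega) (by omega))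
      have d1 : L = 1 → zigv n (k + L - 1) = zigv n k := fun h => by simp [h]
      have d2 : L' = 1 → zigv n (k' + L' - 1) = zigv n k' := fun h => by simp [h]
      have : L = 1 ∧ L' = 1 := by
        clear s1 s2
        rcases Nat.lt_or_ge 1 L with a | a <;> rcases Nat.lt_or_ge 1 L' with b | b
        · have := c1 a; have := c2 b; omega
        · have := c1 a; have := d2 (by omega); omega
        · have := c2 b; have := d1 (by omega); omega
        · omega
      rw [this.1, this.2]
      simp [zw, hhead]
    · have a1 := first_ext n hn L k D hh
      rw [hF] at hh
      have a2 := first_ext n hn L' k' D hh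
      rw [a1] at a2
      split_ifs at a2 <;> omega

lemma zz_word (n : ℕ) (u : WC n) (hu : IsZZ n u ∨ IsPZZ n u) :
    ∃ l, (csC n).IsReduced l ∧ (csC n).wordProd l = u ∧ 0 < l.length ∧
      ∃ k, l.map Fin.val = zw n k l.length := by
  have key : ∀ l : List (Fin (n + 1)), IsZigWord n l → ∃ k, l.map Fin.val = zw n k l.length := by
    rintro l ⟨k, hk⟩
    refine ⟨k, hk.trans ?_⟩
    unfold zw
    rw [List.range'_eq_map_range, List.map_map]
    rfl
  rcases hu with ⟨-, l, h1, h2, h3, i, -, -, h4⟩ | ⟨-, l, h1, h2, h3, -, ⟨x, y, h4⟩, -⟩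
  · refine ⟨l, h1, h2, ?_, key l h3⟩
    rw [List.length_pos_iff]
    rintro rfl
    simp at h4
  · refine ⟨l, h1, h2, ?_, key l h3⟩
    rw [List.length_pos_iff]
    rintro rfl
    simp at h4

lemma zw_get (n k : ℕ) (l : List (Fin (n + 1))) (h : l.map Fin.val = zw n k l.length) (t : ℕ)
    (ht : t < l.length) : (l.get ⟨t, ht⟩).val = zigv n (k + t) := by
  have h1 : (l.map Fin.val)[t]? = (zw n k l.length)[t]? := by rw [h]
  simp [zw, ht, List.getElem?_range'] at h1
  simpa using h1

/-- Let `ũ ≠ w̃` be two distinct elements of `(ZZ)` or `(PZZ)`.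
Then the decorated diagrams `dec_Z(ũ)` and `dec_Z(w̃)` are distinct. -/
theorem statement11 (n : ℕ) (hn : 2 ≤ n) (u w : WC n)
    (hu : IsZZ n u ∨ IsPZZ n u) (hw : IsZZ n w ∨ IsPZZ n w) (hne : u ≠ w)
    (d d' : DecDiagram n) (hd : DecZSpec n u d) (hd' : DecZSpec n w d') :
    d ≠ d' := by
  rintro rfl
  obtain ⟨l, hl1, hl2, hl3, k, hk⟩ := zz_word n u hu
  obtain ⟨l', hl1', hl2', hl3', k', hk'⟩ := zz_word n w hw
  obtain ⟨he, -, a, b, a', b', -, -, -, -, -, -, -, -, -, -, hv⟩ := hd l hl1 hl2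
  obtain ⟨he', -, c, e, c', e', -, -, -, -, -, -, -, -, -, -, hv'⟩ := hd' l' hl1' hl2'
  have hg := zw_get n k l hk
  have hg' := zw_get n k' l' hk'
  have hadj' : ∀ t, t + 1 < l'.length → zigv n (k' + (t + 1)) = zigv n (k' + t) + 1 ∨
      zigv n (k' + t) = zigv n (k' + (t + 1)) + 1 := fun t _ => zigv_succ n (k' + t) hn
  have hhead : zigv n k = zigv n k' := by
    have hz := zigv_le n k
    have h := north_mem n l hl3 ⟨zigv n k, by omega⟩ ⟨zigv n k + 1, by omega⟩ rfl
      (by rw [hg 0 hl3]; rfl)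
    exact north_edge n l' (fun t => zigv n (k' + t)) hg' hadj' _ _ rfl
      ((he' _ _).mp ((he _ _).mpr h))
  have hlast : zigv n (k + l.length - 1) = zigv n (k' + l'.length - 1) := by
    have hz := zigv_le n (k + l.length - 1)
    have h := south_mem n l hl3 ⟨zigv n (k + l.length - 1), by omega⟩
      ⟨zigv n (k + l.length - 1) + 1, by omega⟩ rfl
      (by rw [hg _ (by omega)]; exact congrArg (zigv n) (Nat.add_sub_assoc hl3 k))
    have := south_edge n l' (fun t => zigv n (k' + t)) hl3' hg' hadj' _ _ rfl
      ((he' _ _).mp ((he _ _).mpr h))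
    rw [Nat.add_sub_assoc (show 1 ≤ l'.length from hl3')]
    exact this
  have hF1 : d.vorder.map Prod.snd = (l.map Fin.val).filterMap (decoOf n) := by
    rw [hv, List.map_filterMap, List.filterMap_map]
    congr 1
    funext i
    simp only [Function.comp, decoOf]
    split_ifs <;> rfl
  have hF2 : d.vorder.map Prod.snd = (l'.map Fin.val).filterMap (decoOf n) := by
    rw [hv', List.map_filterMap, List.filterMap_map]
    congr 1
    funext i
    simp only [Function.comp, decoOf]
    split_ifs <;> rfl
  have hfin : l.map Fin.val = l'.map Fin.val := by
    rw [hk, hk']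
    rw [hk] at hF1
    rw [hk'] at hF2
    exact zw_eq n k _ k' _ hn hl3 hl3' hhead hlast (hF1.symm.trans hF2)
  have := List.map_injective_iff.mpr Fin.val_injective hfin
  exact hne (by rw [← hl2, ← hl2', this])

end BCF
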